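/- The second-order left-invariant differential operator ∂x² − ∂y² − 2x ∂z∂y + 2y ∂z∂x + (y² − x²) ∂z² + ∂z² on ℝ³ (coordinates (z,y,x)) is solvable on smooth functions: for every g ∈ C^∞(ℝ³,ℂ) there exists f ∈ C^∞(ℝ³,ℂ) such that (∂x² − ∂y² − 2x ∂z∂y + 2y ∂z∂x + (y² − x²) ∂z² + ∂z²) f = g. -/

import Mathlib

open Complex

/-- Partial derivative in the first coordinate `z` of a function on `ℝ³`
(coordinates written `(z, y, x)`). -/
noncomputable def Pz (f : ℝ × ℝ × ℝ → ℂ) : ℝ × ℝ × ℝ → ℂ :=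
  fun p => deriv (fun t => f (t, p.2.1, p.2.2)) p.1

/-- Partial derivative in the second coordinate `y`. -/
noncomputable def Py (f : ℝ × ℝ × ℝ → ℂ) : ℝ × ℝ × ℝ → ℂ :=
  fun p => deriv (fun t => f (p.1, t, p.2.2)) p.2.1

/-- Partial derivative in the third coordinate `x`. -/
noncomputable def Px (f : ℝ × ℝ × ℝ → ℂ) : ℝ × ℝ × ℝ → ℂ :=
  fun p => deriv (fun t => f (p.1, p.2.1, t)) p.2.2

/-- The second-order left-invariant operator
`∂x² − ∂y² − 2x ∂z∂y + 2y ∂z∂x + (y² − x²) ∂z² + ∂z²`. -/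
noncomputable def OpL2 (f : ℝ × ℝ × ℝ → ℂ) : ℝ × ℝ × ℝ → ℂ :=
  fun p => Px (Px f) p - Py (Py f) p
    - 2 * (p.2.2 : ℂ) * Pz (Py f) p
    + 2 * (p.2.1 : ℂ) * Pz (Px f) p
    + ((p.2.1 : ℂ) ^ 2 - (p.2.2 : ℂ) ^ 2) * Pz (Pz f) p
    + Pz (Pz f) p


open MeasureTheory intervalIntegral Set

/-- Differentiation under the integral sign for smooth integrands. -/
theorem param_hasFDerivAt {E G : Type} [NormedAddCommGroup E] [NormedSpace ℝ E] [ProperSpace E]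
    [NormedAddCommGroup G] [NormedSpace ℝ G] (a b : ℝ)
    (F : E × ℝ → G) (hF : ContDiff ℝ (⊤ : ℕ∞) F) (x : E) :
    HasFDerivAt (fun x => ∫ t in a..b, F (x, t))
      (∫ t in a..b, (fderiv ℝ F (x, t)).comp (ContinuousLinearMap.inl ℝ E ℝ)) x := by
  have hF' : Continuous (fun q : E × ℝ =>
      (fderiv ℝ F q).comp (ContinuousLinearMap.inl ℝ E ℝ)) := by
    have h1 : Continuous (fderiv ℝ F) := hF.continuous_fderiv (by simp)
    fun_prop
  have hc : Continuous F := hF.continuous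
  obtain ⟨C, hC⟩ := ((isCompact_closedBall x 1).prod (isCompact_uIcc (a := a) (b := b))).exists_bound_of_continuousOn
    hF'.continuousOn
  refine intervalIntegral.hasFDerivAt_integral_of_dominated_of_fderiv_le
    (F := fun x t => F (x, t))
    (F' := fun x t => (fderiv ℝ F (x, t)).comp (ContinuousLinearMap.inl ℝ E ℝ))
    (bound := fun _ => C)
    (Metric.closedBall_mem_nhds x one_pos) ?_ ?_ ?_ ?_ ?_ ?_
  · refine Filter.Eventually.of_forall fun y => ?_
    exact (Continuous.aestronglyMeasurable (by fun_prop))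
  · exact Continuous.intervalIntegrable (by fun_prop) _ _
  · exact (Continuous.aestronglyMeasurable
      (hF'.comp (by fun_prop : Continuous fun t : ℝ => (x, t))))
  · refine Filter.Eventually.of_forall fun t ht y hy => ?_
    exact hC (y, t) ⟨hy, uIoc_subset_uIcc ht⟩
  · simp
  · refine Filter.Eventually.of_forall fun t ht y hy => ?_
    have h1 : HasFDerivAt F (fderiv ℝ F (y, t)) (y, t) :=
      (hF.differentiable (by simp)).differentiableAt.hasFDerivAt
    exact h1.comp y (hasFDerivAt_prodMk_left y t)

theorem param_contDiff_nat {E : Type} [NormedAddCommGroup E] [NormedSpace ℝ E] [ProperSpace E]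
    (a b : ℝ) (n : ℕ) : ∀ (G : Type) [NormedAddCommGroup G] [NormedSpace ℝ G]
    (F : E × ℝ → G) (_ : ContDiff ℝ (⊤ : ℕ∞) F),
    ContDiff ℝ n (fun x => ∫ t in a..b, F (x, t)) := by
  induction n with
  | zero =>
    intro G _ _ F hF
    rw [Nat.cast_zero, contDiff_zero]
    exact continuous_iff_continuousAt.2 fun x => (param_hasFDerivAt a b F hF x).continuousAt
  | succ n ih =>
    intro G _ _ F hF
    rw [Nat.cast_succ, contDiff_succ_iff_fderiv]
    refine ⟨fun x => (param_hasFDerivAt a b F hF x).differentiableAt, by simp, ?_⟩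
    have : fderiv ℝ (fun x => ∫ t in a..b, F (x, t)) = fun x =>
      ∫ t in a..b, (fun q : E × ℝ =>
        (fderiv ℝ F q).comp (ContinuousLinearMap.inl ℝ E ℝ)) (x, t) := by
      ext1 x
      exact (param_hasFDerivAt a b F hF x).fderiv
    rw [this]
    refine ih (E →L[ℝ] G) (fun q : E × ℝ =>
        (fderiv ℝ F q).comp (ContinuousLinearMap.inl ℝ E ℝ)) ?_
    have h1 : ContDiff ℝ (⊤ : ℕ∞) (fderiv ℝ F) := hF.fderiv_right (by simp)
    exact h1.clm_comp contDiff_const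

theorem param_contDiff {E G : Type} [NormedAddCommGroup E] [NormedSpace ℝ E] [ProperSpace E]
    [NormedAddCommGroup G] [NormedSpace ℝ G] (a b : ℝ)
    (F : E × ℝ → G) (hF : ContDiff ℝ (⊤ : ℕ∞) F) :
    ContDiff ℝ (⊤ : ℕ∞) (fun x => ∫ t in a..b, F (x, t)) :=
  contDiff_infty.2 fun n => param_contDiff_nat a b n G F hF

theorem param_hasDerivAt (a b : ℝ) (F : ℝ × ℝ → ℂ) (hF : ContDiff ℝ (⊤ : ℕ∞) F) (x : ℝ)
    (F' : ℝ → ℂ) (hF' : ∀ t, HasDerivAt (fun x => F (x, t)) (F' t) x) :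
    HasDerivAt (fun x => ∫ t in a..b, F (x, t)) (∫ t in a..b, F' t) x := by
  have h := (param_hasFDerivAt a b F hF x).hasDerivAt
  refine h.congr_deriv ?_
  rw [ContinuousLinearMap.intervalIntegral_apply]
  · congr 1
    ext1 t
    have h1 : HasFDerivAt F (fderiv ℝ F (x, t)) (x, t) :=
      (hF.differentiable (by simp)).differentiableAt.hasFDerivAt
    exact ((hF' t).unique (h1.comp x (hasFDerivAt_prodMk_left x t)).hasDerivAt).symm
  · apply Continuous.intervalIntegrable
    have h1 : Continuous (fderiv ℝ F) := hF.continuous_fderiv (by simp)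
    fun_prop

/-- Leibniz rule with a moving endpoint. -/
theorem leibniz (F : ℝ × ℝ → ℂ) (hF : ContDiff ℝ (⊤ : ℕ∞) F) (x : ℝ)
    (F' : ℝ → ℂ) (hF' : ∀ t, HasDerivAt (fun x => F (x, t)) (F' t) x) :
    HasDerivAt (fun x => ∫ t in (0 : ℝ)..x, F (x, t)) (F (x, x) + ∫ t in (0 : ℝ)..x, F' t) x := by
  have hH : ContDiff ℝ (⊤ : ℕ∞) (fun q : ℝ × ℝ => ∫ t in (0 : ℝ)..q.1, F (q.2, t)) := by
    have : (fun q : ℝ × ℝ => ∫ t in (0 : ℝ)..q.1, F (q.2, t)) =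
        fun q : ℝ × ℝ => q.1 • ∫ t in (0 : ℝ)..1,
          (fun r : (ℝ × ℝ) × ℝ => F (r.1.2, r.1.1 * r.2)) (q, t) := by
      ext1 q
      have := intervalIntegral.smul_integral_comp_mul_left (a := 0) (b := 1)
        (fun t => F (q.2, t)) q.1
      simp only [mul_zero, mul_one] at this
      exact this.symm
    rw [this]
    exact contDiff_fst.smul (param_contDiff 0 1
      (fun r : (ℝ × ℝ) × ℝ => F (r.1.2, r.1.1 * r.2)) (by fun_prop))
  have hd : HasFDerivAt (fun q : ℝ × ℝ => ∫ t in (0 : ℝ)..q.1, F (q.2, t))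
      _ (x, x) := (hH.differentiable (by simp)).differentiableAt.hasFDerivAt
  have hc : Continuous F := hF.continuous
  have e1 := hd.comp_hasDerivAt (f := fun y : ℝ => (y, x)) x ((hasDerivAt_id x).prodMk (hasDerivAt_const x x))
  have e2 := hd.comp_hasDerivAt (f := fun y : ℝ => (x, y)) x ((hasDerivAt_const x x).prodMk (hasDerivAt_id x))
  have e1' : HasDerivAt (fun y => ∫ t in (0 : ℝ)..y, F (x, t)) (F (x, x)) x := by
    exact intervalIntegral.integral_hasDerivAt_right
      (Continuous.intervalIntegrable (by fun_prop) _ _)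
      (Continuous.stronglyMeasurableAtFilter (by fun_prop) _ _) (by fun_prop)
  have e2' := param_hasDerivAt 0 x F hF x F' hF'
  have f1 := e1.unique e1'
  have f2 := e2.unique e2'
  have e3 := hd.comp_hasDerivAt (f := fun y : ℝ => (y, y)) x ((hasDerivAt_id x).prodMk (hasDerivAt_id x))
  refine e3.congr_deriv ?_
  rw [← f1, ← f2, ← map_add]
  simp

/-- Smooth functions on `ℝ³`. -/
def Smooth3 (h : ℝ × ℝ × ℝ → ℂ) : Prop := ContDiff ℝ (⊤ : ℕ∞) h

theorem Smooth3.hasFDerivAt {h : ℝ × ℝ × ℝ → ℂ} (hh : Smooth3 h) (p : ℝ × ℝ × ℝ) :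
    HasFDerivAt h (fderiv ℝ h p) p :=
  (ContDiff.differentiable hh (by simp)).differentiableAt.hasFDerivAt

theorem Pz_eq {h : ℝ × ℝ × ℝ → ℂ} (hh : Smooth3 h) (p : ℝ × ℝ × ℝ) :
    Pz h p = fderiv ℝ h p (1, 0, 0) :=
  ((hh.hasFDerivAt p).comp_hasDerivAt (f := fun t : ℝ => (t, p.2.1, p.2.2)) p.1
    ((hasDerivAt_id p.1).prodMk (hasDerivAt_const _ _))).deriv

theorem Py_eq {h : ℝ × ℝ × ℝ → ℂ} (hh : Smooth3 h) (p : ℝ × ℝ × ℝ) :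
    Py h p = fderiv ℝ h p (0, 1, 0) :=
  ((hh.hasFDerivAt p).comp_hasDerivAt (f := fun t : ℝ => (p.1, t, p.2.2)) p.2.1
    ((hasDerivAt_const _ _).prodMk ((hasDerivAt_id p.2.1).prodMk (hasDerivAt_const _ _)))).deriv

theorem Px_eq {h : ℝ × ℝ × ℝ → ℂ} (hh : Smooth3 h) (p : ℝ × ℝ × ℝ) :
    Px h p = fderiv ℝ h p (0, 0, 1) :=
  ((hh.hasFDerivAt p).comp_hasDerivAt (f := fun t : ℝ => (p.1, p.2.1, t)) p.2.2
    ((hasDerivAt_const _ _).prodMk ((hasDerivAt_const _ _).prodMk (hasDerivAt_id p.2.2)))).deriv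

theorem smooth_dir {h : ℝ × ℝ × ℝ → ℂ} (hh : Smooth3 h) (v : ℝ × ℝ × ℝ) :
    Smooth3 (fun p => fderiv ℝ h p v) := by
  have h1 : ContDiff ℝ (⊤ : ℕ∞) (fderiv ℝ h) := ContDiff.fderiv_right hh (by simp)
  exact h1.clm_apply contDiff_const

theorem Smooth3.z {h : ℝ × ℝ × ℝ → ℂ} (hh : Smooth3 h) : Smooth3 (Pz h) := by
  rw [show Pz h = _ from funext (Pz_eq hh)]; exact smooth_dir hh _

theorem Smooth3.y {h : ℝ × ℝ × ℝ → ℂ} (hh : Smooth3 h) : Smooth3 (Py h) := by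
  rw [show Py h = _ from funext (Py_eq hh)]; exact smooth_dir hh _

theorem Smooth3.x {h : ℝ × ℝ × ℝ → ℂ} (hh : Smooth3 h) : Smooth3 (Px h) := by
  rw [show Px h = _ from funext (Px_eq hh)]; exact smooth_dir hh _

theorem dir_comm {h : ℝ × ℝ × ℝ → ℂ} (hh : Smooth3 h) (v w p : ℝ × ℝ × ℝ) :
    fderiv ℝ (fun p => fderiv ℝ h p v) p w = fderiv ℝ (fun p => fderiv ℝ h p w) p v := by
  have h1 : ContDiff ℝ (⊤ : ℕ∞) (fderiv ℝ h) := ContDiff.fderiv_right hh (by simp)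
  have h2 : DifferentiableAt ℝ (fderiv ℝ h) p := (h1.differentiable (by simp)).differentiableAt
  rw [fderiv_clm_apply h2 (by fun_prop), fderiv_clm_apply h2 (by fun_prop)]
  have h3 : IsSymmSndFDerivAt ℝ h p :=
    ContDiffAt.isSymmSndFDerivAt (n := (⊤ : ℕ∞)) (ContDiff.contDiffAt hh)
      (by simp only [minSmoothness_of_isRCLikeNormedField]; exact WithTop.coe_le_coe.2 le_top)
  simpa using h3 w v

theorem Pxz_comm {h : ℝ × ℝ × ℝ → ℂ} (hh : Smooth3 h) (p : ℝ × ℝ × ℝ) :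
    Px (Pz h) p = Pz (Px h) p := by
  rw [Px_eq hh.z, Pz_eq hh.x, show Pz h = _ from funext (Pz_eq hh),
    show Px h = _ from funext (Px_eq hh)]
  exact dir_comm hh _ _ _

theorem Pyz_comm {h : ℝ × ℝ × ℝ → ℂ} (hh : Smooth3 h) (p : ℝ × ℝ × ℝ) :
    Py (Pz h) p = Pz (Py h) p := by
  rw [Py_eq hh.z, Pz_eq hh.y, show Pz h = _ from funext (Pz_eq hh),
    show Py h = _ from funext (Py_eq hh)]
  exact dir_comm hh _ _ _

theorem chain3 {h : ℝ × ℝ × ℝ → ℂ} (hh : Smooth3 h) {a b c : ℝ → ℝ} {a' b' c' t : ℝ}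
    (ha : HasDerivAt a a' t) (hb : HasDerivAt b b' t) (hc : HasDerivAt c c' t) :
    HasDerivAt (fun s => h (a s, b s, c s)) (a' • Pz h (a t, b t, c t)
      + b' • Py h (a t, b t, c t) + c' • Px h (a t, b t, c t)) t := by
  have := (hh.hasFDerivAt (a t, b t, c t)).comp_hasDerivAt (f := fun s => (a s, b s, c s)) t
    (ha.prodMk (hb.prodMk hc))
  refine this.congr_deriv ?_
  rw [Pz_eq hh, Py_eq hh, Px_eq hh, ← map_smul, ← map_smul, ← map_smul, ← map_add, ← map_add]
  simp

/-- Integration over the angular rectangle. -/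
noncomputable def dbl (k : ℝ × ℝ → ℂ) : ℂ :=
  ∫ φ in (0 : ℝ)..(2 * Real.pi), ∫ θ in (0 : ℝ)..Real.pi, k (φ, θ)

theorem dbl_add {k l : ℝ × ℝ → ℂ} (hk : Continuous k) (hl : Continuous l) :
    dbl (fun q => k q + l q) = dbl k + dbl l := by
  unfold dbl
  rw [← intervalIntegral.integral_add]
  · congr 1
    ext1 φ
    exact intervalIntegral.integral_add (Continuous.intervalIntegrable (by fun_prop) _ _)
      (Continuous.intervalIntegrable (by fun_prop) _ _)
  · exact Continuous.intervalIntegrable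
      (intervalIntegral.continuous_parametric_intervalIntegral_of_continuous'
        (f := fun φ θ => k (φ, θ)) (by exact hk) _ _) _ _
  · exact Continuous.intervalIntegrable
      (intervalIntegral.continuous_parametric_intervalIntegral_of_continuous'
        (f := fun φ θ => l (φ, θ)) (by exact hl) _ _) _ _

theorem dbl_smul (c : ℝ) (k : ℝ × ℝ → ℂ) : dbl (fun q => c • k q) = c • dbl k := by
  unfold dbl
  simp only [intervalIntegral.integral_smul]

theorem dbl_contDiff {E : Type} [NormedAddCommGroup E] [NormedSpace ℝ E] [ProperSpace E]
    (K : (E × ℝ) × ℝ → ℂ) (hK : ContDiff ℝ (⊤ : ℕ∞) K) :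
    ContDiff ℝ (⊤ : ℕ∞) (fun x => dbl (fun q => K ((x, q.1), q.2))) :=
  param_contDiff _ _ (fun r : E × ℝ => ∫ θ in (0 : ℝ)..Real.pi, K (r, θ))
    (param_contDiff _ _ K hK)

theorem dbl_hasDerivAt (K : (ℝ × ℝ) × ℝ → ℂ) (hK : ContDiff ℝ (⊤ : ℕ∞) K) (x : ℝ)
    (K' : ℝ × ℝ → ℂ) (hK' : ∀ φ θ, HasDerivAt (fun x => K ((x, φ), θ)) (K' (φ, θ)) x) :
    HasDerivAt (fun x => dbl (fun q => K ((x, q.1), q.2))) (dbl K') x :=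
  param_hasDerivAt _ _ (fun r : ℝ × ℝ => ∫ θ in (0 : ℝ)..Real.pi, K (r, θ))
    (param_contDiff _ _ K hK) x _ fun φ =>
      param_hasDerivAt _ _ (fun r : ℝ × ℝ => K ((r.1, φ), r.2)) (by fun_prop) x _
        fun θ => hK' φ θ

/-- The point `p + τ w(θ, φ)` of the projected sphere, with `q = (φ, θ)`. -/
noncomputable def cc (p : ℝ × ℝ × ℝ) (τ : ℝ) (q : ℝ × ℝ) : ℝ × ℝ × ℝ :=
  (p.1 + τ * (Real.sin q.2 * Real.cos q.1), p.2.1, p.2.2 + τ * (Real.sin q.2 * Real.sin q.1))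

/-- (Unnormalised) spherical mean. -/
noncomputable def mm (h : ℝ × ℝ × ℝ → ℂ) (p : ℝ × ℝ × ℝ) (τ : ℝ) : ℂ :=
  dbl (fun q => Real.sin q.2 • h (cc p τ q))

noncomputable def m1 (h : ℝ × ℝ × ℝ → ℂ) (p : ℝ × ℝ × ℝ) (τ : ℝ) : ℂ :=
  dbl (fun q => Real.sin q.2 • ((Real.sin q.2 * Real.cos q.1) • Pz h (cc p τ q)
    + (Real.sin q.2 * Real.sin q.1) • Px h (cc p τ q)))

noncomputable def m2 (h : ℝ × ℝ × ℝ → ℂ) (p : ℝ × ℝ × ℝ) (τ : ℝ) : ℂ :=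
  dbl (fun q => Real.sin q.2 • ((Real.sin q.2 * Real.cos q.1) ^ 2 • Pz (Pz h) (cc p τ q)
    + (2 * (Real.sin q.2 * Real.cos q.1) * (Real.sin q.2 * Real.sin q.1)) • Pz (Px h) (cc p τ q)
    + (Real.sin q.2 * Real.sin q.1) ^ 2 • Px (Px h) (cc p τ q)))

theorem contDiff_sin' : ContDiff ℝ (⊤ : ℕ∞) Real.sin := Real.contDiff_sin
theorem contDiff_cos' : ContDiff ℝ (⊤ : ℕ∞) Real.cos := Real.contDiff_cos

theorem mm_contDiff {h : ℝ × ℝ × ℝ → ℂ} (hh : Smooth3 h) :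
    ContDiff ℝ (⊤ : ℕ∞) (fun r : (ℝ × ℝ × ℝ) × ℝ => mm h r.1 r.2) := by
  have hh' : ContDiff ℝ (⊤ : ℕ∞) h := hh
  unfold mm cc
  exact dbl_contDiff (fun s : (((ℝ × ℝ × ℝ) × ℝ) × ℝ) × ℝ =>
    Real.sin s.2 • h (cc s.1.1.1 s.1.1.2 (s.1.2, s.2))) (by unfold cc; fun_prop)

theorem m1_contDiff {h : ℝ × ℝ × ℝ → ℂ} (hh : Smooth3 h) :
    ContDiff ℝ (⊤ : ℕ∞) (fun r : (ℝ × ℝ × ℝ) × ℝ => m1 h r.1 r.2) := by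
  have h1 : ContDiff ℝ (⊤ : ℕ∞) (Pz h) := hh.z
  have h2 : ContDiff ℝ (⊤ : ℕ∞) (Px h) := hh.x
  unfold m1 cc
  exact dbl_contDiff (fun s : (((ℝ × ℝ × ℝ) × ℝ) × ℝ) × ℝ =>
    Real.sin s.2 • ((Real.sin s.2 * Real.cos s.1.2) • Pz h (cc s.1.1.1 s.1.1.2 (s.1.2, s.2))
    + (Real.sin s.2 * Real.sin s.1.2) • Px h (cc s.1.1.1 s.1.1.2 (s.1.2, s.2))))
    (by unfold cc; fun_prop)

theorem cc_chain_tau {h : ℝ × ℝ × ℝ → ℂ} (hh : Smooth3 h) (p : ℝ × ℝ × ℝ) (τ : ℝ) (q : ℝ × ℝ) :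
    HasDerivAt (fun τ => h (cc p τ q)) ((Real.sin q.2 * Real.cos q.1) • Pz h (cc p τ q)
      + (Real.sin q.2 * Real.sin q.1) • Px h (cc p τ q)) τ := by
  have := chain3 hh (t := τ)
    (((hasDerivAt_id τ).mul_const (Real.sin q.2 * Real.cos q.1)).const_add p.1)
    (hasDerivAt_const τ p.2.1)
    (((hasDerivAt_id τ).mul_const (Real.sin q.2 * Real.sin q.1)).const_add p.2.2)
  simpa [cc] using this

theorem cc_chain_theta {h : ℝ × ℝ × ℝ → ℂ} (hh : Smooth3 h) (p : ℝ × ℝ × ℝ) (τ φ θ : ℝ) :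
    HasDerivAt (fun θ => h (cc p τ (φ, θ)))
      ((τ * (Real.cos θ * Real.cos φ)) • Pz h (cc p τ (φ, θ))
      + (τ * (Real.cos θ * Real.sin φ)) • Px h (cc p τ (φ, θ))) θ := by
  have := chain3 hh (t := θ)
    ((((Real.hasDerivAt_sin θ).mul_const (Real.cos φ)).const_mul τ).const_add p.1)
    (hasDerivAt_const θ p.2.1)
    ((((Real.hasDerivAt_sin θ).mul_const (Real.sin φ)).const_mul τ).const_add p.2.2)
  simpa [cc] using this

theorem cc_chain_phi {h : ℝ × ℝ × ℝ → ℂ} (hh : Smooth3 h) (p : ℝ × ℝ × ℝ) (τ φ θ : ℝ) :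
    HasDerivAt (fun φ => h (cc p τ (φ, θ)))
      ((τ * (Real.sin θ * -Real.sin φ)) • Pz h (cc p τ (φ, θ))
      + (τ * (Real.sin θ * Real.cos φ)) • Px h (cc p τ (φ, θ))) φ := by
  have := chain3 hh (t := φ)
    ((((Real.hasDerivAt_cos φ).const_mul (Real.sin θ)).const_mul τ).const_add p.1)
    (hasDerivAt_const φ p.2.1)
    ((((Real.hasDerivAt_sin φ).const_mul (Real.sin θ)).const_mul τ).const_add p.2.2)
  simpa [cc] using this

theorem mm_hasDerivAt {h : ℝ × ℝ × ℝ → ℂ} (hh : Smooth3 h) (p : ℝ × ℝ × ℝ) (τ : ℝ) :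
    HasDerivAt (mm h p) (m1 h p τ) τ := by
  have hh' : ContDiff ℝ (⊤ : ℕ∞) h := hh
  refine dbl_hasDerivAt (fun s : (ℝ × ℝ) × ℝ => Real.sin s.2 • h (cc p s.1.1 (s.1.2, s.2)))
    (by unfold cc; fun_prop) τ _ fun φ θ => ?_
  exact (cc_chain_tau hh p τ (φ, θ)).const_smul (Real.sin θ)

theorem m1_hasDerivAt {h : ℝ × ℝ × ℝ → ℂ} (hh : Smooth3 h) (p : ℝ × ℝ × ℝ) (τ : ℝ) :
    HasDerivAt (m1 h p) (m2 h p τ) τ := by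
  have h1 : ContDiff ℝ (⊤ : ℕ∞) (Pz h) := hh.z
  have h2 : ContDiff ℝ (⊤ : ℕ∞) (Px h) := hh.x
  refine dbl_hasDerivAt (fun s : (ℝ × ℝ) × ℝ =>
    Real.sin s.2 • ((Real.sin s.2 * Real.cos s.1.2) • Pz h (cc p s.1.1 (s.1.2, s.2))
    + (Real.sin s.2 * Real.sin s.1.2) • Px h (cc p s.1.1 (s.1.2, s.2))))
    (by unfold cc; fun_prop) τ _ fun φ θ => ?_
  refine ((((cc_chain_tau hh.z p τ (φ, θ)).const_smul (Real.sin θ * Real.cos φ)).add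
    ((cc_chain_tau hh.x p τ (φ, θ)).const_smul (Real.sin θ * Real.sin φ))).const_smul
      (Real.sin θ)).congr_deriv ?_
  simp only [Pxz_comm hh]
  module

theorem mm_hasDerivAt_z {h : ℝ × ℝ × ℝ → ℂ} (hh : Smooth3 h) (z y x τ : ℝ) :
    HasDerivAt (fun z => mm h (z, y, x) τ) (mm (Pz h) (z, y, x) τ) z := by
  have hh' : ContDiff ℝ (⊤ : ℕ∞) h := hh
  refine dbl_hasDerivAt (fun s : (ℝ × ℝ) × ℝ =>
    Real.sin s.2 • h (cc (s.1.1, y, x) τ (s.1.2, s.2)))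
    (by unfold cc; fun_prop) z _ fun φ θ => ?_
  refine HasDerivAt.const_smul (Real.sin θ) (f := fun z => h (cc (z, y, x) τ (φ, θ))) ?_
  have := chain3 hh (t := z) ((hasDerivAt_id z).add_const (τ * (Real.sin θ * Real.cos φ)))
    (hasDerivAt_const z y) (hasDerivAt_const z (x + τ * (Real.sin θ * Real.sin φ)))
  simpa [cc] using this

theorem mm_hasDerivAt_x {h : ℝ × ℝ × ℝ → ℂ} (hh : Smooth3 h) (z y x τ : ℝ) :
    HasDerivAt (fun x => mm h (z, y, x) τ) (mm (Px h) (z, y, x) τ) x := by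
  have hh' : ContDiff ℝ (⊤ : ℕ∞) h := hh
  refine dbl_hasDerivAt (fun s : (ℝ × ℝ) × ℝ =>
    Real.sin s.2 • h (cc (z, y, s.1.1) τ (s.1.2, s.2)))
    (by unfold cc; fun_prop) x _ fun φ θ => ?_
  refine HasDerivAt.const_smul (Real.sin θ) (f := fun x => h (cc (z, y, x) τ (φ, θ))) ?_
  have := chain3 hh (t := x) (hasDerivAt_const x (z + τ * (Real.sin θ * Real.cos φ)))
    (hasDerivAt_const x y) ((hasDerivAt_id x).add_const (τ * (Real.sin θ * Real.sin φ)))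
  simpa [cc] using this

theorem mm_zero (h : ℝ × ℝ × ℝ → ℂ) (p : ℝ × ℝ × ℝ) : mm h p 0 = (4 * Real.pi) • h p := by
  have e : ∫ θ in (0 : ℝ)..Real.pi, Real.sin θ = 2 := by
    rw [integral_sin]; simp; norm_num
  simp only [mm, dbl, cc, zero_mul, add_zero, intervalIntegral.integral_smul_const, e]
  simp only [intervalIntegral.integral_const, sub_zero]
  congr 1
  ring

/-- The polar part of the spherical Laplacian. -/
noncomputable def dP (h : ℝ × ℝ × ℝ → ℂ) (p : ℝ × ℝ × ℝ) (τ : ℝ) (q : ℝ × ℝ) : ℂ :=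
  Real.cos q.2 • ((Real.cos q.2 * Real.cos q.1) • Pz h (cc p τ q)
      + (Real.cos q.2 * Real.sin q.1) • Px h (cc p τ q))
    + Real.sin q.2 • (-(Real.sin q.2 * Real.cos q.1) • Pz h (cc p τ q)
      - (Real.sin q.2 * Real.sin q.1) • Px h (cc p τ q)
      + τ • ((Real.cos q.2 * Real.cos q.1) ^ 2 • Pz (Pz h) (cc p τ q)
        + (2 * (Real.cos q.2 * Real.cos q.1) * (Real.cos q.2 * Real.sin q.1))
          • Pz (Px h) (cc p τ q)
        + (Real.cos q.2 * Real.sin q.1) ^ 2 • Px (Px h) (cc p τ q)))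

/-- The azimuthal part of the spherical Laplacian. -/
noncomputable def dQ (h : ℝ × ℝ × ℝ → ℂ) (p : ℝ × ℝ × ℝ) (τ : ℝ) (q : ℝ × ℝ) : ℂ :=
  - Real.cos q.1 • Pz h (cc p τ q) - Real.sin q.1 • Px h (cc p τ q)
    + (τ * Real.sin q.2) • (Real.sin q.1 ^ 2 • Pz (Pz h) (cc p τ q)
        - (2 * Real.sin q.1 * Real.cos q.1) • Pz (Px h) (cc p τ q)
        + Real.cos q.1 ^ 2 • Px (Px h) (cc p τ q))

theorem dbl_dP {h : ℝ × ℝ × ℝ → ℂ} (hh : Smooth3 h) (p : ℝ × ℝ × ℝ) (τ : ℝ) :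
    dbl (dP h p τ) = 0 := by
  have h1 := hh.z.continuous
  have h2 := hh.x.continuous
  have h3 := hh.z.z.continuous
  have h4 := hh.x.z.continuous
  have h5 := hh.x.x.continuous
  unfold dbl
  have : ∀ φ, ∫ θ in (0 : ℝ)..Real.pi, dP h p τ (φ, θ) = 0 := by
    intro φ
    rw [intervalIntegral.integral_eq_sub_of_hasDerivAt
      (f := fun θ => Real.sin θ • ((Real.cos θ * Real.cos φ) • Pz h (cc p τ (φ, θ))
      + (Real.cos θ * Real.sin φ) • Px h (cc p τ (φ, θ))))]
    · simp
    · intro θ _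
      refine ((Real.hasDerivAt_sin θ).smul
        ((((Real.hasDerivAt_cos θ).mul_const (Real.cos φ)).smul (cc_chain_theta hh.z p τ φ θ)).add
        (((Real.hasDerivAt_cos θ).mul_const (Real.sin φ)).smul
          (cc_chain_theta hh.x p τ φ θ)))).congr_deriv ?_
      simp only [Pxz_comm hh, dP, Pi.add_apply, Pi.smul_apply']
      module
    · apply Continuous.intervalIntegrable
      unfold dP cc
      fun_prop
  simp [this]

theorem dbl_dQ {h : ℝ × ℝ × ℝ → ℂ} (hh : Smooth3 h) (p : ℝ × ℝ × ℝ) (τ : ℝ) :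
    dbl (dQ h p τ) = 0 := by
  have g1 : ContDiff ℝ (⊤ : ℕ∞) (Pz h) := hh.z
  have g2 : ContDiff ℝ (⊤ : ℕ∞) (Px h) := hh.x
  have h1 := hh.z.continuous
  have h2 := hh.x.continuous
  have h3 := hh.z.z.continuous
  have h4 := hh.x.z.continuous
  have h5 := hh.x.x.continuous
  unfold dbl
  rw [intervalIntegral.integral_eq_sub_of_hasDerivAt
    (f := fun φ => ∫ θ in (0 : ℝ)..Real.pi, (fun r : ℝ × ℝ => -Real.sin r.1 • Pz h (cc p τ r)
      + Real.cos r.1 • Px h (cc p τ r)) (φ, θ))]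
  · simp [cc]
  · intro φ _
    refine param_hasDerivAt _ _ (fun r : ℝ × ℝ => -Real.sin r.1 • Pz h (cc p τ r)
      + Real.cos r.1 • Px h (cc p τ r)) (by unfold cc; fun_prop) φ _ fun θ => ?_
    refine (((Real.hasDerivAt_sin φ).neg.smul (cc_chain_phi hh.z p τ φ θ)).add
      ((Real.hasDerivAt_cos φ).smul (cc_chain_phi hh.x p τ φ θ))).congr_deriv ?_
    simp only [Pxz_comm hh, dQ, Pi.neg_apply]
    module
  · apply Continuous.intervalIntegrable
    apply intervalIntegral.continuous_parametric_intervalIntegral_of_continuous'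
      (f := fun φ θ => dQ h p τ (φ, θ))
    unfold dQ cc
    simp only [Function.uncurry_def]
    fun_prop

/-- Darboux equation. -/
theorem darboux {h : ℝ × ℝ × ℝ → ℂ} (hh : Smooth3 h) (p : ℝ × ℝ × ℝ) (τ : ℝ) :
    (2 : ℝ) • m1 h p τ + τ • m2 h p τ = τ • (mm (Pz (Pz h)) p τ + mm (Px (Px h)) p τ) := by
  have h1 := hh.z.continuous
  have h2 := hh.x.continuous
  have h3 := hh.z.z.continuous
  have h4 := hh.x.z.continuous
  have h5 := hh.x.x.continuous
  have key : (2 : ℝ) • m1 h p τ + τ • m2 h p τ + (dbl (dP h p τ) + dbl (dQ h p τ))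
      = τ • (mm (Pz (Pz h)) p τ + mm (Px (Px h)) p τ) := by
    unfold m1 m2 mm
    rw [← dbl_smul, ← dbl_smul, ← dbl_add, ← dbl_add, ← dbl_add, ← dbl_add, ← dbl_smul]
    · congr 1
      ext1 q
      have e1 : (Real.sin q.2 : ℂ) ^ 2 + (Real.cos q.2 : ℂ) ^ 2 = 1 := by
        exact_mod_cast Real.sin_sq_add_cos_sq q.2
      have e2 : (Real.sin q.1 : ℂ) ^ 2 + (Real.cos q.1 : ℂ) ^ 2 = 1 := by
        exact_mod_cast Real.sin_sq_add_cos_sq q.1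
      simp only [dP, dQ, Complex.real_smul]
      generalize Pz h (cc p τ q) = A
      generalize Px h (cc p τ q) = B
      generalize Pz (Pz h) (cc p τ q) = A1
      generalize Pz (Px h) (cc p τ q) = A2
      generalize Px (Px h) (cc p τ q) = A3
      push_cast at e1 e2 ⊢
      generalize Complex.sin q.2 = S at *
      generalize Complex.cos q.2 = C at *
      generalize Complex.sin q.1 = s at *
      generalize Complex.cos q.1 = c at *
      linear_combination (c * A + s * B + τ * S * (c ^ 2 * A1 + 2 * c * s * A2 + s ^ 2 * A3)) * e1
        + (τ * S * (A1 + A3)) * e2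
    all_goals (try unfold dP); (try unfold dQ); unfold cc; fun_prop
  rwa [dbl_dP hh, dbl_dQ hh, add_zero, add_zero] at key

/-- Duhamel solution of the inhomogeneous wave equation. -/
noncomputable def UU (h : ℝ × ℝ × ℝ → ℂ) (p : ℝ × ℝ × ℝ) : ℂ :=
  ∫ s in (0 : ℝ)..p.2.1, (p.2.1 - s) • mm h (p.1, s, p.2.2) (p.2.1 - s)

theorem UU_smooth {h : ℝ × ℝ × ℝ → ℂ} (hh : Smooth3 h) : Smooth3 (UU h) := by
  have hm := mm_contDiff hh
  have : UU h = fun p : ℝ × ℝ × ℝ => p.2.1 • ∫ s in (0 : ℝ)..1,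
      (fun r : (ℝ × ℝ × ℝ) × ℝ => (r.1.2.1 - r.1.2.1 * r.2) •
        (fun r : (ℝ × ℝ × ℝ) × ℝ => mm h r.1 r.2)
          ((r.1.1, r.1.2.1 * r.2, r.1.2.2), (r.1.2.1 - r.1.2.1 * r.2))) (p, s) := by
    ext1 p
    have := intervalIntegral.smul_integral_comp_mul_left (a := 0) (b := 1)
      (fun s => (p.2.1 - s) • mm h (p.1, s, p.2.2) (p.2.1 - s)) p.2.1
    simp only [mul_zero, mul_one] at this
    exact this.symm
  rw [this]
  unfold Smooth3
  refine ContDiff.smul (f := fun p : ℝ × ℝ × ℝ => p.2.1) (by fun_prop) (param_contDiff 0 1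
    (fun r : (ℝ × ℝ × ℝ) × ℝ => (r.1.2.1 - r.1.2.1 * r.2) •
        (fun r : (ℝ × ℝ × ℝ) × ℝ => mm h r.1 r.2)
          ((r.1.1, r.1.2.1 * r.2, r.1.2.2), (r.1.2.1 - r.1.2.1 * r.2))) ?_)
  refine ContDiff.smul (f := fun r : (ℝ × ℝ × ℝ) × ℝ => r.1.2.1 - r.1.2.1 * r.2)
    (by fun_prop) (hm.comp (g := fun r : (ℝ × ℝ × ℝ) × ℝ => mm h r.1 r.2)
    (f := fun r : (ℝ × ℝ × ℝ) × ℝ =>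
      ((r.1.1, r.1.2.1 * r.2, r.1.2.2), (r.1.2.1 - r.1.2.1 * r.2))) (by fun_prop))

theorem Pz_UU {h : ℝ × ℝ × ℝ → ℂ} (hh : Smooth3 h) : Pz (UU h) = UU (Pz h) := by
  ext1 p
  have hm := mm_contDiff hh
  refine (param_hasDerivAt 0 p.2.1 (fun r : ℝ × ℝ => (p.2.1 - r.2) •
    mm h (r.1, r.2, p.2.2) (p.2.1 - r.2)) ?_ p.1 _ fun s => ?_).deriv
  · exact ContDiff.smul (f := fun r : ℝ × ℝ => p.2.1 - r.2) (by fun_prop) (hm.comp (g := fun r : (ℝ × ℝ × ℝ) × ℝ => mm h r.1 r.2)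
      (f := fun r : ℝ × ℝ => ((r.1, r.2, p.2.2), (p.2.1 - r.2))) (by fun_prop))
  · exact (mm_hasDerivAt_z hh p.1 s p.2.2 (p.2.1 - s)).const_smul (p.2.1 - s)

theorem Px_UU {h : ℝ × ℝ × ℝ → ℂ} (hh : Smooth3 h) : Px (UU h) = UU (Px h) := by
  ext1 p
  have hm := mm_contDiff hh
  refine (param_hasDerivAt 0 p.2.1 (fun r : ℝ × ℝ => (p.2.1 - r.2) •
    mm h (p.1, r.2, r.1) (p.2.1 - r.2)) ?_ p.2.2 _ fun s => ?_).deriv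
  · exact ContDiff.smul (f := fun r : ℝ × ℝ => p.2.1 - r.2) (by fun_prop) (hm.comp (g := fun r : (ℝ × ℝ × ℝ) × ℝ => mm h r.1 r.2)
      (f := fun r : ℝ × ℝ => ((p.1, r.2, r.1), (p.2.1 - r.2))) (by fun_prop))
  · exact (mm_hasDerivAt_x hh p.1 s p.2.2 (p.2.1 - s)).const_smul (p.2.1 - s)

theorem Py_UU {h : ℝ × ℝ × ℝ → ℂ} (hh : Smooth3 h) :
    Py (UU h) = fun p => ∫ s in (0 : ℝ)..p.2.1, (mm h (p.1, s, p.2.2) (p.2.1 - s)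
      + (p.2.1 - s) • m1 h (p.1, s, p.2.2) (p.2.1 - s)) := by
  ext1 p
  have hm := mm_contDiff hh
  refine (leibniz (fun r : ℝ × ℝ => (r.1 - r.2) •
    mm h (p.1, r.2, p.2.2) (r.1 - r.2)) ?_ p.2.1 (fun s => mm h (p.1, s, p.2.2) (p.2.1 - s)
      + (p.2.1 - s) • m1 h (p.1, s, p.2.2) (p.2.1 - s)) fun s => ?_).deriv.trans ?_
  · exact ContDiff.smul (f := fun r : ℝ × ℝ => r.1 - r.2) (by fun_prop) (hm.comp (g := fun r : (ℝ × ℝ × ℝ) × ℝ => mm h r.1 r.2)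
      (f := fun r : ℝ × ℝ => ((p.1, r.2, p.2.2), (r.1 - r.2))) (by fun_prop))
  · have hd : HasDerivAt (fun y : ℝ => y - s) 1 p.2.1 := (hasDerivAt_id _).sub_const s
    have h2 := (mm_hasDerivAt hh (p.1, s, p.2.2) (p.2.1 - s)).scomp p.2.1 hd
    refine (hd.smul h2).congr_deriv ?_
    simp [add_comm]
  · simp

theorem Pyy_UU {h : ℝ × ℝ × ℝ → ℂ} (hh : Smooth3 h) (p : ℝ × ℝ × ℝ) :
    Py (Py (UU h)) p = (4 * Real.pi) • h p + UU (Pz (Pz h)) p + UU (Px (Px h)) p := by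
  rw [Py_UU hh]
  have hm := mm_contDiff hh
  have hn := m1_contDiff hh
  have hmc (k : ℝ × ℝ × ℝ → ℂ) (hk : Smooth3 k) :
      Continuous fun s : ℝ => (p.2.1 - s) • mm k (p.1, s, p.2.2) (p.2.1 - s) := by
    refine Continuous.smul (f := fun s : ℝ => p.2.1 - s) (by fun_prop) ((mm_contDiff hk).continuous.comp
      (f := fun s : ℝ => ((p.1, s, p.2.2), (p.2.1 - s))) (by fun_prop))
  refine (leibniz (fun r : ℝ × ℝ => mm h (p.1, r.2, p.2.2) (r.1 - r.2) + (r.1 - r.2) •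
    m1 h (p.1, r.2, p.2.2) (r.1 - r.2)) ?_ p.2.1 (fun s =>
      (p.2.1 - s) • mm (Pz (Pz h)) (p.1, s, p.2.2) (p.2.1 - s)
      + (p.2.1 - s) • mm (Px (Px h)) (p.1, s, p.2.2) (p.2.1 - s)) fun s => ?_).deriv.trans ?_
  · exact (hm.comp (g := fun r : (ℝ × ℝ × ℝ) × ℝ => mm h r.1 r.2)
      (f := fun r : ℝ × ℝ => ((p.1, r.2, p.2.2), (r.1 - r.2))) (by fun_prop)).add
      (ContDiff.smul (f := fun r : ℝ × ℝ => r.1 - r.2) (by fun_prop) (hn.comp (g := fun r : (ℝ × ℝ × ℝ) × ℝ => m1 h r.1 r.2)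
      (f := fun r : ℝ × ℝ => ((p.1, r.2, p.2.2), (r.1 - r.2))) (by fun_prop)))
  · have hd : HasDerivAt (fun y : ℝ => y - s) 1 p.2.1 := (hasDerivAt_id _).sub_const s
    have h1 := (mm_hasDerivAt hh (p.1, s, p.2.2) (p.2.1 - s)).scomp p.2.1 hd
    have h2 := (m1_hasDerivAt hh (p.1, s, p.2.2) (p.2.1 - s)).scomp p.2.1 hd
    refine (h1.add (hd.smul h2)).congr_deriv ?_
    rw [← smul_add, ← darboux hh]
    simp only [Function.comp_apply]
    module
  · rw [intervalIntegral.integral_add ((hmc _ hh.z.z).intervalIntegrable _ _)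
      ((hmc _ hh.x.x).intervalIntegrable _ _)]
    simp only [sub_self, zero_smul, add_zero, mm_zero, UU, add_assoc]

/-- Pullback along the shear. -/
def shear (u : ℝ × ℝ × ℝ → ℂ) (p : ℝ × ℝ × ℝ) : ℂ := u (p.1 - p.2.2 * p.2.1, p.2.1, p.2.2)

theorem shear_z {u : ℝ × ℝ × ℝ → ℂ} (hu : Smooth3 u) (z y x : ℝ) :
    HasDerivAt (fun z => shear u (z, y, x)) (shear (Pz u) (z, y, x)) z := by
  have := chain3 hu (t := z) ((hasDerivAt_id z).sub_const (x * y))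
    (hasDerivAt_const z y) (hasDerivAt_const z x)
  simpa [shear] using this

theorem shear_y {u : ℝ × ℝ × ℝ → ℂ} (hu : Smooth3 u) (z y x : ℝ) :
    HasDerivAt (fun y => shear u (z, y, x))
      (shear (Py u) (z, y, x) - x • shear (Pz u) (z, y, x)) y := by
  have := chain3 hu (t := y) (((hasDerivAt_id y).const_mul x).const_sub z)
    (hasDerivAt_id y) (hasDerivAt_const y x)
  refine this.congr_deriv ?_
  simp [shear]
  ring

theorem shear_x {u : ℝ × ℝ × ℝ → ℂ} (hu : Smooth3 u) (z y x : ℝ) :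
    HasDerivAt (fun x => shear u (z, y, x))
      (shear (Px u) (z, y, x) - y • shear (Pz u) (z, y, x)) x := by
  have := chain3 hu (t := x) (((hasDerivAt_id x).mul_const y).const_sub z)
    (hasDerivAt_const x y) (hasDerivAt_id x)
  refine this.congr_deriv ?_
  simp [shear]
  ring

theorem OpL2_shear {u : ℝ × ℝ × ℝ → ℂ} (hu : Smooth3 u) (p : ℝ × ℝ × ℝ) :
    OpL2 (shear u) p = shear (Px (Px u)) p - shear (Py (Py u)) p + shear (Pz (Pz u)) p := by
  have fz : Pz (shear u) = fun p => shear (Pz u) p :=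
    funext fun p => (shear_z hu p.1 p.2.1 p.2.2).deriv
  have fy : Py (shear u) = fun p => shear (Py u) p - p.2.2 • shear (Pz u) p :=
    funext fun p => (shear_y hu p.1 p.2.1 p.2.2).deriv
  have fx : Px (shear u) = fun p => shear (Px u) p - p.2.1 • shear (Pz u) p :=
    funext fun p => (shear_x hu p.1 p.2.1 p.2.2).deriv
  have fzz : Pz (Pz (shear u)) p = shear (Pz (Pz u)) p := by
    rw [fz]; exact (shear_z hu.z p.1 p.2.1 p.2.2).deriv
  have fzy : Pz (Py (shear u)) p = shear (Pz (Py u)) p - p.2.2 • shear (Pz (Pz u)) p := by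
    rw [fy]; exact ((shear_z hu.y p.1 p.2.1 p.2.2).sub
      ((shear_z hu.z p.1 p.2.1 p.2.2).const_smul p.2.2)).deriv
  have fzx : Pz (Px (shear u)) p = shear (Pz (Px u)) p - p.2.1 • shear (Pz (Pz u)) p := by
    rw [fx]; exact ((shear_z hu.x p.1 p.2.1 p.2.2).sub
      ((shear_z hu.z p.1 p.2.1 p.2.2).const_smul p.2.1)).deriv
  have fyy : Py (Py (shear u)) p = (shear (Py (Py u)) p - p.2.2 • shear (Pz (Py u)) p)
      - p.2.2 • (shear (Py (Pz u)) p - p.2.2 • shear (Pz (Pz u)) p) := by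
    rw [fy]; exact ((shear_y hu.y p.1 p.2.1 p.2.2).sub
      ((shear_y hu.z p.1 p.2.1 p.2.2).const_smul p.2.2)).deriv
  have fxx : Px (Px (shear u)) p = (shear (Px (Px u)) p - p.2.1 • shear (Pz (Px u)) p)
      - p.2.1 • (shear (Px (Pz u)) p - p.2.1 • shear (Pz (Pz u)) p) := by
    rw [fx]; exact ((shear_x hu.x p.1 p.2.1 p.2.2).sub
      ((shear_x hu.z p.1 p.2.1 p.2.2).const_smul p.2.1)).deriv
  have c1 : shear (Px (Pz u)) p = shear (Pz (Px u)) p := Pxz_comm hu _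
  have c2 : shear (Py (Pz u)) p = shear (Pz (Py u)) p := Pyz_comm hu _
  unfold OpL2
  rw [fzz, fzy, fzx, fyy, fxx, c1, c2]
  simp only [Complex.real_smul]
  ring

/-- The operator `∂x² − ∂y² − 2x ∂z∂y + 2y ∂z∂x + (y² − x²) ∂z² + ∂z²`
is solvable on smooth functions. -/
theorem opL2_solvable (g : ℝ × ℝ × ℝ → ℂ) (hg : ContDiff ℝ (⊤ : ℕ∞) g) :
    ∃ f : ℝ × ℝ × ℝ → ℂ, ContDiff ℝ (⊤ : ℕ∞) f ∧ ∀ p : ℝ × ℝ × ℝ, OpL2 f p = g p := by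
  have hg' : ContDiff ℝ (⊤ : ℕ∞) g := hg
  let h : ℝ × ℝ × ℝ → ℂ := fun p => (-(4 * Real.pi)⁻¹ : ℝ) • g (p.1 + p.2.2 * p.2.1, p.2.1, p.2.2)
  have hh : Smooth3 h := by
    change ContDiff ℝ (⊤ : ℕ∞) fun p : ℝ × ℝ × ℝ =>
      (-(4 * Real.pi)⁻¹ : ℝ) • g (p.1 + p.2.2 * p.2.1, p.2.1, p.2.2)
    fun_prop
  have hu := UU_smooth hh
  refine ⟨shear (UU h), ?_, fun p => ?_⟩
  · have hu' : ContDiff ℝ (⊤ : ℕ∞) (UU h) := hu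
    change ContDiff ℝ (⊤ : ℕ∞) fun p : ℝ × ℝ × ℝ =>
      UU h (p.1 - p.2.2 * p.2.1, p.2.1, p.2.2)
    fun_prop
  · rw [OpL2_shear hu, Pz_UU hh, Pz_UU hh.z, Px_UU hh, Px_UU hh.x]
    unfold shear
    rw [Pyy_UU hh]
    have e : (4 * Real.pi) • h (p.1 - p.2.2 * p.2.1, p.2.1, p.2.2) = - g p := by
      simp only [h, smul_smul, sub_add_cancel]
      rw [mul_neg, mul_inv_cancel₀ (by positivity), neg_one_smul]
    rw [e]
    ring
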